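/- Raising relation in the second degree index n₂: for every real q with 0 < q < 1, every integer N ≥ 1, all nonzero real numbers θ, φ, all integers n₁, n₂ ≥ 0 with n₁+n₂ ≤ N-1, and all integers x₁, x₂ ≥ 0 with x₁+x₂ ≤ N, one has q^{N-n₂} K_{n₁,n₂+1}(x₁,x₂; θ, q^{1/2}φ; N) = (1-q^{x₁})(1-φ^{-2}q^{N-x₁-x₂}) K_{n₁,n₂}(x₁-1,x₂; θ,φ; N-1) + q^{x₁}(1-q^{x₂})(1-φ^{-2}q^{N-x₁-x₂}) K_{n₁,n₂}(x₁,x₂-1; θ,φ; N-1) + q^{x₁+x₂}(1-q^{N-x₁-x₂}) K_{n₁,n₂}(x₁,x₂; θ,φ; N-1). -/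

import Mathlib

open Finset

/-- The q-Pochhammer symbol `(a;q)_n = ∏_{k=0}^{n-1} (1 - a q^k)`. -/
noncomputable def qPoch (q a : ℝ) (n : ℕ) : ℝ := ∏ k ∈ Finset.range n, (1 - a * q ^ k)

/-- The quantum q-Krawtchouk polynomial `k_n(x;p,N;q)`, defined for all integers `x, N`. -/
noncomputable def qKraw (q : ℝ) (n : ℕ) (x N : ℤ) (p : ℝ) : ℝ :=
  (-1 : ℝ) ^ n * q ^ (n * (n - 1) / 2) *
    ∑ k ∈ Finset.range (n + 1),
      qPoch q (q ^ (-(n : ℤ))) k * qPoch q (q ^ (-x)) k *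
        qPoch q (q ^ ((k : ℤ) - N)) (n - k) / qPoch q q k * (p * q ^ (n + 1)) ^ k

/-- The bivariate quantum q-Krawtchouk polynomial of Gasper and Rahman,
`K_{n₁,n₂}(x₁,x₂;θ,φ;N) = k_{n₁}(x₁;θ^{-2},x₁+x₂;q) k_{n₂}(x₁+x₂-n₁;φ^{-2},N-n₁;q)`,
with the convention that it vanishes when a degree index is negative. -/
noncomputable def Kq (q : ℝ) (n₁ n₂ x₁ x₂ : ℤ) (θ φ : ℝ) (N : ℤ) : ℝ :=
  if 0 ≤ n₁ ∧ 0 ≤ n₂ then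
    qKraw q n₁.toNat x₁ (x₁ + x₂) (θ ^ 2)⁻¹ *
      qKraw q n₂.toNat (x₁ + x₂ - n₁) (N - n₁) (φ ^ 2)⁻¹
  else 0

/-- The q-trinomial coefficient `[N; x₁, x₂]_q`. -/
noncomputable def qTrinom (q : ℝ) (N x₁ x₂ : ℕ) : ℝ :=
  qPoch q q N / (qPoch q q x₁ * qPoch q q x₂ * qPoch q q (N - x₁ - x₂))

/-- The orthogonality weight `Δ^{(N)}_{x₁,x₂}(θ,φ)`. -/
noncomputable def Δw (q : ℝ) (N x₁ x₂ : ℕ) (θ φ : ℝ) : ℝ :=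
  (-1 : ℝ) ^ (N - x₁) * (θ ^ 2 * q⁻¹) ^ (x₁ + x₂) * q ^ (x₁ * (x₁ - 1) / 2) *
    qTrinom q N x₁ x₂ * qPoch q ((θ ^ 2)⁻¹ * q) x₂ * qPoch q ((φ ^ 2)⁻¹ * q) (N - x₁ - x₂) *
    φ ^ (2 * N) * q ^ (-((N : ℤ) * (N + 1) / 2))

/-- The normalization constant `H^{(N)}_{n₁,n₂}(θ,φ)`. -/
noncomputable def Hn (q : ℝ) (N n₁ n₂ : ℕ) (θ φ : ℝ) : ℝ :=
  (-1 : ℝ) ^ (n₁ + n₂) * qPoch q (q * (θ ^ 2)⁻¹) n₁ * qPoch q (q * (φ ^ 2)⁻¹) n₂ *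
    φ ^ (2 * n₁) * (qPoch q q N / qPoch q q (N - n₁ - n₂)) ^ 2 * (qTrinom q N n₁ n₂)⁻¹ *
    q ^ (3 * ((n₁ : ℤ) * (n₁ - 1)) / 2 + 3 * ((n₂ : ℤ) * (n₂ - 1)) / 2 +
          (n₁ : ℤ) * n₂ - (N : ℤ) * (n₁ + n₂) - 2 * n₁ - n₂)

/-- The dual weight `Δ̃^{(N)}_{n₁,n₂}(θ,φ)`. -/
noncomputable def Δdual (q : ℝ) (N n₁ n₂ : ℕ) (θ φ : ℝ) : ℝ :=
  (-1 : ℝ) ^ (n₁ + n₂) * q ^ (-((n₁ : ℤ) * (n₁ - 1)) - (n₂ : ℤ) * (n₂ - 1)) *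
    φ ^ (-(2 * (n₁ : ℤ))) * (qPoch q q (N - n₁ - n₂) / qPoch q q N) ^ 2 * qTrinom q N n₁ n₂ *
    q ^ ((N : ℤ) * (n₁ + n₂) + 2 * n₁ + n₂ - (n₁ : ℤ) * n₂ -
          (n₁ : ℤ) * (n₁ - 1) / 2 - (n₂ : ℤ) * (n₂ - 1) / 2) /
    (qPoch q (q * (θ ^ 2)⁻¹) n₁ * qPoch q (q * (φ ^ 2)⁻¹) n₂)

lemma qPoch_succ (q a : ℝ) (n : ℕ) :
    qPoch q a (n + 1) = qPoch q a n * (1 - a * q ^ n) :=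
  Finset.prod_range_succ _ _

lemma qPoch_succ' (q a : ℝ) (n : ℕ) :
    qPoch q a (n + 1) = (1 - a) * qPoch q (a * q) n := by
  unfold qPoch
  rw [Finset.prod_range_succ', mul_comm]
  congr 1
  · simp
  · exact Finset.prod_congr rfl fun k _ => by ring

lemma one_sub_mul_qPoch_mul (q a : ℝ) (n : ℕ) :
    (1 - a) * qPoch q (a * q) n = qPoch q a n * (1 - a * q ^ n) := by
  rw [← qPoch_succ', qPoch_succ]

lemma qPoch_self_ne_zero {q : ℝ} (hq0 : 0 < q) (hq1 : q < 1) (n : ℕ) : qPoch q q n ≠ 0 := by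
  refine Finset.prod_ne_zero_iff.mpr fun k _ => ?_
  have h : q ^ (k + 1) < 1 := pow_lt_one₀ hq0.le hq1 k.succ_ne_zero
  rw [pow_succ'] at h
  exact (sub_pos.mpr h).ne'

/-- The unnormalized quantum q-Krawtchouk sum, with `a`, `A`, `c` in place of
`q^{-x}`, `q^{-N}`, `q^{-n}`. -/
noncomputable def qKrawSum (q : ℝ) (n : ℕ) (c a A z : ℝ) : ℝ :=
  ∑ k ∈ Finset.range (n + 1),
    qPoch q c k * qPoch q a k * qPoch q (q ^ k * A) (n - k) / qPoch q q k * z ^ k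

lemma qKraw_eq_qKrawSum {q : ℝ} (hq0 : 0 < q) (n : ℕ) (x N : ℤ) (p : ℝ) :
    qKraw q n x N p = (-1 : ℝ) ^ n * q ^ (n * (n - 1) / 2) *
      qKrawSum q n (q ^ (-(n : ℤ))) (q ^ (-x)) (q ^ (-N)) (p * q ^ (n + 1)) := by
  unfold qKraw qKrawSum
  congr 1
  refine Finset.sum_congr rfl fun k _ => ?_
  rw [sub_eq_add_neg, zpow_add₀ hq0.ne', zpow_natCast]

lemma qKrawSum_contiguous (q : ℝ) (n : ℕ) (c z : ℝ) {a A : ℝ} (ha : a ≠ 0) (hA : A ≠ 0) :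
    (1 - a⁻¹) * qKrawSum q n c (a * q) (A * q) z
      + a⁻¹ * (1 - a * A⁻¹) * qKrawSum q n c a (A * q) z
      = (q ^ n - A⁻¹) * qKrawSum q n c a A z := by
  unfold qKrawSum
  simp only [Finset.mul_sum]
  rw [← Finset.sum_add_distrib]
  refine Finset.sum_congr rfl fun k hk => ?_
  have hk : k ≤ n := Nat.lt_succ_iff.mp (Finset.mem_range.mp hk)
  have h1 := one_sub_mul_qPoch_mul q a k
  have h2 := one_sub_mul_qPoch_mul q (q ^ k * A) (n - k)
  rw [show q ^ k * A * q ^ (n - k) = q ^ n * A by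
    rw [mul_right_comm, ← pow_add, Nat.add_sub_cancel' hk]] at h2
  rw [← mul_assoc (q ^ k) A q]
  have h3 : (1 - a⁻¹) * qPoch q (a * q) k = -a⁻¹ * (qPoch q a k * (1 - a * q ^ k)) := by
    rw [← h1]; field_simp; ring
  have h4 : (q ^ n - A⁻¹) * qPoch q (q ^ k * A) (n - k)
      = (q ^ k - A⁻¹) * qPoch q (q ^ k * A * q) (n - k) := by
    have : (q ^ n - A⁻¹) * qPoch q (q ^ k * A) (n - k)
      = -A⁻¹ * (qPoch q (q ^ k * A) (n - k) * (1 - q ^ n * A)) := by field_simp; ring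
    rw [this, ← h2]; field_simp; ring
  have h5 : a⁻¹ * a = 1 := inv_mul_cancel₀ ha
  linear_combination (qPoch q c k * qPoch q (q ^ k * A * q) (n - k) / qPoch q q k * z ^ k) * h3
    - (qPoch q c k * qPoch q a k / qPoch q q k * z ^ k) * h4
    + (qPoch q c k * qPoch q a k * qPoch q (q ^ k * A * q) (n - k) / qPoch q q k * z ^ k)
      * (q ^ k - A⁻¹) * h5

lemma qPoch_div_pascal {q : ℝ} (hq0 : 0 < q) (hq1 : q < 1) (c : ℝ) (k : ℕ) :
    qPoch q c (k + 1) / qPoch q q (k + 1)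
      = qPoch q (c * q) (k + 1) / qPoch q q (k + 1) - c * (qPoch q (c * q) k / qPoch q q k) := by
  have h0 := qPoch_self_ne_zero hq0 hq1 k
  have h1 := qPoch_self_ne_zero hq0 hq1 (k + 1)
  have h2 : 1 - q * q ^ k ≠ 0 := by
    rw [qPoch_succ] at h1
    exact right_ne_zero_of_mul h1
  rw [qPoch_succ', qPoch_succ q (c * q), qPoch_succ q q]
  field_simp
  ring

lemma qPoch_neg_zpow_eq_zero {q : ℝ} (hq0 : 0 < q) (n : ℕ) :
    qPoch q (q ^ (-(n : ℤ))) (n + 1) = 0 := by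
  rw [qPoch_succ, zpow_neg, zpow_natCast, inv_mul_cancel₀ (pow_pos hq0 n).ne', sub_self, mul_zero]

lemma qKrawSum_raising {q : ℝ} (hq0 : 0 < q) (hq1 : q < 1) (n : ℕ) (p : ℝ) {b B : ℝ}
    (hb : b ≠ 0) (hB : B ≠ 0) :
    (1 - p * (b * B⁻¹)) * (1 - b⁻¹) *
        qKrawSum q n (q ^ (-(n : ℤ))) (b * q) (B * q) (p * q ^ (n + 1))
      + b⁻¹ * (1 - b * B⁻¹) * qKrawSum q n (q ^ (-(n : ℤ))) b (B * q) (p * q ^ (n + 1))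
      = -B⁻¹ * qKrawSum q (n + 1) (q ^ (-((n + 1 : ℕ) : ℤ))) b B (p * q ^ (n + 1)) := by
  set z := p * q ^ (n + 1) with hz
  set c := q ^ (-(n : ℤ)) with hc
  set d := q ^ (-((n + 1 : ℕ) : ℤ)) with hd
  have hdq : d * q = c := by
    rw [hd, hc, ← zpow_add_one₀ hq0.ne']; congr 1; push_cast; ring
  have hdz : d * z = p := by
    rw [hd, hz, zpow_neg, zpow_natCast]
    field_simp
  have hvanish : qPoch q c (n + 1) = 0 := qPoch_neg_zpow_eq_zero hq0 n
  set e : ℕ → ℝ := fun k => qPoch q b k * qPoch q (q ^ k * B) (n + 1 - k) with he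
  have hleft : (1 - p * (b * B⁻¹)) * (1 - b⁻¹) * qKrawSum q n c (b * q) (B * q) z
      + b⁻¹ * (1 - b * B⁻¹) * qKrawSum q n c b (B * q) z
      = ∑ k ∈ Finset.range (n + 1), (-B⁻¹ * (qPoch q c k / qPoch q q k * z ^ k * e k)
        + p * B⁻¹ * (qPoch q c k / qPoch q q k * z ^ k * e (k + 1))) := by
    unfold qKrawSum
    simp only [Finset.mul_sum]
    rw [← Finset.sum_add_distrib]
    refine Finset.sum_congr rfl fun k hk => ?_
    have hk : k ≤ n := Nat.lt_succ_iff.mp (Finset.mem_range.mp hk)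
    have h1 := one_sub_mul_qPoch_mul q b k
    have h3 : (1 - b⁻¹) * qPoch q (b * q) k = -b⁻¹ * (qPoch q b k * (1 - b * q ^ k)) := by
      rw [← h1]; field_simp; ring
    have h5 : b⁻¹ * b = 1 := inv_mul_cancel₀ hb
    have h6 : B⁻¹ * B = 1 := inv_mul_cancel₀ hB
    simp only [he]
    rw [Nat.succ_sub hk, Nat.succ_eq_add_one, qPoch_succ' q (q ^ k * B), qPoch_succ q b,
      Nat.add_sub_add_right, ← mul_assoc (q ^ k) B q, show q ^ (k + 1) * B = q ^ k * B * q by ring]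
    set P := qPoch q (q ^ k * B * q) (n - k)
    linear_combination
      (1 - p * (b * B⁻¹)) * (qPoch q c k * P / qPoch q q k * z ^ k) * h3
      + (qPoch q c k * qPoch q b k * P / qPoch q q k * z ^ k)
        * (q ^ k - B⁻¹ + p * B⁻¹ * (1 - b * q ^ k)) * h5
      - (qPoch q c k * qPoch q b k * P / qPoch q q k * z ^ k) * q ^ k * h6
  have hright : qKrawSum q (n + 1) d b B z
      = ∑ k ∈ Finset.range (n + 2), qPoch q d k / qPoch q q k * z ^ k * e k := by
    unfold qKrawSum
    refine Finset.sum_congr rfl fun k _ => ?_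
    simp only [he]
    ring
  have hshift : ∑ k ∈ Finset.range (n + 2), qPoch q d k / qPoch q q k * z ^ k * e k
      = (∑ k ∈ Finset.range (n + 1), qPoch q c k / qPoch q q k * z ^ k * e k)
        - p * ∑ k ∈ Finset.range (n + 1), qPoch q c k / qPoch q q k * z ^ k * e (k + 1) := by
    have hext : ∑ k ∈ Finset.range (n + 1), qPoch q c k / qPoch q q k * z ^ k * e k
        = ∑ k ∈ Finset.range (n + 2), qPoch q c k / qPoch q q k * z ^ k * e k := by
      rw [Finset.sum_range_succ _ (n + 1), hvanish]
      simp
    rw [hext, Finset.sum_range_succ', Finset.sum_range_succ' _ (n + 1), Finset.mul_sum,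
      add_sub_right_comm, ← Finset.sum_sub_distrib]
    congr 1
    refine Finset.sum_congr rfl fun k _ => ?_
    rw [qPoch_div_pascal hq0 hq1 d k, hdq, ← hdz]
    ring
  rw [hleft, hright, hshift, Finset.sum_add_distrib, ← Finset.mul_sum, ← Finset.mul_sum]
  ring

lemma qKraw_contiguous {q : ℝ} (hq0 : 0 < q) (n : ℕ) (x X : ℤ) (p : ℝ) :
    (1 - q ^ x) * qKraw q n (x - 1) (X - 1) p
      + q ^ x * (1 - q ^ (X - x)) * qKraw q n x (X - 1) p
      = (q ^ n - q ^ X) * qKraw q n x X p := by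
  have h := qKrawSum_contiguous q n (q ^ (-(n : ℤ))) (p * q ^ (n + 1))
    (zpow_ne_zero (-x) hq0.ne') (zpow_ne_zero (-X) hq0.ne')
  have hX : q ^ (X - x) = q ^ (-x) * q ^ X := by
    rw [← zpow_add₀ hq0.ne']; congr 1; ring
  have hs (m : ℤ) : q ^ (-(m - 1)) = q ^ (-m) * q := by
    rw [← zpow_add_one₀ hq0.ne']; congr 1; ring
  simp only [← zpow_neg, neg_neg] at h
  simp only [qKraw_eq_qKrawSum hq0, hs, hX]
  linear_combination (-1 : ℝ) ^ n * q ^ (n * (n - 1) / 2) * h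

lemma qKraw_raising {q : ℝ} (hq0 : 0 < q) (hq1 : q < 1) (n : ℕ) (y M : ℤ) (p : ℝ) :
    (1 - p * q ^ (M - y)) * (1 - q ^ y) * qKraw q n (y - 1) (M - 1) p
      + q ^ y * (1 - q ^ (M - y)) * qKraw q n y (M - 1) p
      = q ^ (M - n) * qKraw q (n + 1) y M (q⁻¹ * p) := by
  have h := qKrawSum_raising hq0 hq1 n p
    (zpow_ne_zero (-y) hq0.ne') (zpow_ne_zero (-M) hq0.ne')
  have hM : q ^ (M - y) = q ^ (-y) * q ^ M := by
    rw [← zpow_add₀ hq0.ne']; congr 1; ring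
  have hs (m : ℤ) : q ^ (-(m - 1)) = q ^ (-m) * q := by
    rw [← zpow_add_one₀ hq0.ne']; congr 1; ring
  have hz : q⁻¹ * p * q ^ (n + 1 + 1) = p * q ^ (n + 1) := by
    field_simp
    ring
  have htri : (n + 1) * (n + 1 - 1) / 2 = n * (n - 1) / 2 + n := by
    rw [← Finset.sum_range_id, ← Finset.sum_range_id, Finset.sum_range_succ]
  have hMn : q ^ (M - n) * q ^ n = q ^ M := by
    rw [← zpow_natCast, ← zpow_add₀ hq0.ne', sub_add_cancel]
  simp only [← zpow_neg, neg_neg] at h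
  simp only [qKraw_eq_qKrawSum hq0, hs, hM, hz, htri, pow_add q _ n, pow_succ (-1 : ℝ) n]
  set S := qKrawSum q (n + 1) (q ^ (-((n + 1 : ℕ) : ℤ))) (q ^ (-y)) (q ^ (-M)) (p * q ^ (n + 1))
  linear_combination (-1 : ℝ) ^ n * q ^ (n * (n - 1) / 2) * h
    + (-1 : ℝ) ^ n * q ^ (n * (n - 1) / 2) * S * hMn

/-- Raising relation in the second degree index `n₂`. -/
theorem raising_n2 (q : ℝ) (hq0 : 0 < q) (hq1 : q < 1)
    (N : ℕ) (hN : 1 ≤ N) (θ φ : ℝ) (hθ : θ ≠ 0) (hφ : φ ≠ 0)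
    (n₁ n₂ : ℕ) (hn : n₁ + n₂ ≤ N - 1) (x₁ x₂ : ℕ) (hx : x₁ + x₂ ≤ N) :
    q ^ ((N : ℤ) - n₂) * Kq q n₁ (n₂ + 1) x₁ x₂ θ (Real.sqrt q * φ) N
    = (1 - q ^ x₁) * (1 - (φ ^ 2)⁻¹ * q ^ ((N : ℤ) - x₁ - x₂)) *
        Kq q n₁ n₂ ((x₁ : ℤ) - 1) x₂ θ φ ((N : ℤ) - 1)
      + q ^ x₁ * (1 - q ^ x₂) * (1 - (φ ^ 2)⁻¹ * q ^ ((N : ℤ) - x₁ - x₂)) *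
        Kq q n₁ n₂ x₁ ((x₂ : ℤ) - 1) θ φ ((N : ℤ) - 1)
      + q ^ (x₁ + x₂) * (1 - q ^ ((N : ℤ) - x₁ - x₂)) *
        Kq q n₁ n₂ x₁ x₂ θ φ ((N : ℤ) - 1) := by
  have hp : ((Real.sqrt q * φ) ^ 2)⁻¹ = q⁻¹ * (φ ^ 2)⁻¹ := by
    rw [mul_pow, Real.sq_sqrt hq0.le, mul_inv]
  have hn₂ : (0 : ℤ) ≤ n₂ + 1 := by positivity
  have hcast : ((n₂ : ℤ) + 1).toNat = n₂ + 1 := by omega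
  simp only [Kq, Nat.cast_nonneg, hn₂, and_self, if_true, Int.toNat_natCast, hcast, hp]
  have hA := qKraw_contiguous hq0 n₁ x₁ (x₁ + x₂) (θ ^ 2)⁻¹
  have hB := qKraw_raising hq0 hq1 n₂ (x₁ + x₂ - n₁) (N - n₁) (φ ^ 2)⁻¹
  rw [show (N : ℤ) - n₁ - (x₁ + x₂ - n₁) = N - x₁ - x₂ by ring,
    show (x₁ : ℤ) + x₂ - n₁ - 1 = x₁ + x₂ - 1 - n₁ by ring,
    show (N : ℤ) - n₁ - 1 = N - 1 - n₁ by ring] at hB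
  rw [add_sub_cancel_left] at hA
  rw [show (x₁ : ℤ) - 1 + x₂ = x₁ + x₂ - 1 by ring,
    show (x₁ : ℤ) + (x₂ - 1) = x₁ + x₂ - 1 by ring]
  have hX : q ^ ((x₁ : ℤ) + x₂ - n₁) * q ^ n₁ = q ^ ((x₁ : ℤ) + x₂) := by
    rw [← zpow_natCast q n₁, ← zpow_add₀ hq0.ne', sub_add_cancel]
  have hN' : q ^ ((N : ℤ) - n₁ - n₂) * q ^ n₁ = q ^ ((N : ℤ) - n₂) := by
    rw [← zpow_natCast q n₁, ← zpow_add₀ hq0.ne']; congr 1; ring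
  have hXpow : q ^ ((x₁ : ℤ) + x₂) = q ^ (x₁ + x₂) := by
    rw [← zpow_natCast, Nat.cast_add]
  simp only [zpow_natCast] at hA hB
  rw [hXpow] at hX hA
  rw [← hN']
  rw [← hX] at hA ⊢
  set k := qKraw q n₁ x₁ (x₁ + x₂) (θ ^ 2)⁻¹
  set k' := qKraw q n₂ (x₁ + x₂ - 1 - n₁) (N - 1 - n₁) (φ ^ 2)⁻¹
  linear_combination -(q ^ n₁ * k) * hB
    - (1 - (φ ^ 2)⁻¹ * q ^ ((N : ℤ) - x₁ - x₂)) * k' * hA
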